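/- Let $d \ge 1$, $\frac{1}{2} < \alpha < 1$ and $r \in [2,\infty]$. There is a constant $C = C(d, \alpha, r)$ such that for every $k \in \mathbb{Z}$, every $t \ne 0$, and every Schwartz function $f$ on $\mathbb{R}^d$ whose Fourier transform is supported in the annulus $\{\xi : 2^{k-1} \le |\xi| \le 2^{k+1}\}$: $\|e^{-it(-\Delta)^\alpha} f\|_{L^r(\mathbb{R}^d)} \le C\, 2^{k d (1-\alpha)\left(1 - \frac{2}{r}\right)}\, |t|^{-\frac{d}{2}\left(1 - \frac{2}{r}\right)}\, \|f\|_{L^{r'}(\mathbb{R}^d)}$, where $r'$ is the conjugate exponent of $r$. -/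

import Mathlib

open MeasureTheory Complex
open scoped ENNReal BigOperators RealInnerProductSpace

noncomputable section

abbrev Ed (d : ℕ) := EuclideanSpace ℝ (Fin d)

/-- Fourier transform with convention `(𝓕 f) ξ = ∫ e^{-i x·ξ} f x dx`. -/
def FT {d : ℕ} (f : Ed d → ℂ) (ξ : Ed d) : ℂ :=
  ∫ x : Ed d, Complex.exp (-Complex.I * ((⟪x, ξ⟫ : ℝ) : ℂ)) * f x

/-- Inverse Fourier transform `(2π)^{-d} ∫ e^{i x·ξ} g ξ dξ`. -/
def FTinv {d : ℕ} (g : Ed d → ℂ) (x : Ed d) : ℂ :=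
  (((2 * Real.pi) ^ (-(d : ℝ)) : ℝ) : ℂ) *
    ∫ ξ : Ed d, Complex.exp (Complex.I * ((⟪x, ξ⟫ : ℝ) : ℂ)) * g ξ

/-- Fractional Schrödinger propagator `e^{-it(-Δ)^s}`. -/
def fprop {d : ℕ} (s t : ℝ) (f : Ed d → ℂ) : Ed d → ℂ :=
  FTinv (fun ξ => Complex.exp (-Complex.I * (t : ℂ) * ((‖ξ‖ ^ (2 * s) : ℝ) : ℂ)) * FT f ξ)

/-- Fractional derivative `D^σ = (-Δ)^{σ/2}`, the Fourier multiplier `|ξ|^σ`. -/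
def fracD {d : ℕ} (σ : ℝ) (f : Ed d → ℂ) : Ed d → ℂ :=
  FTinv (fun ξ => ((‖ξ‖ ^ σ : ℝ) : ℂ) * FT f ξ)

/-- `(-Δ)^{β/2} e^{-it(-Δ)^s}`. -/
def fracDProp {d : ℕ} (β s t : ℝ) (f : Ed d → ℂ) : Ed d → ℂ :=
  FTinv (fun ξ => ((‖ξ‖ ^ β : ℝ) : ℂ) *
    Complex.exp (-Complex.I * (t : ℂ) * ((‖ξ‖ ^ (2 * s) : ℝ) : ℂ)) * FT f ξ)

/-- Resolvent `(-Δ + λ)⁻¹`. -/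
def resolv {d : ℕ} (lam : ℝ) (f : Ed d → ℂ) : Ed d → ℂ :=
  FTinv (fun ξ => FT f ξ / ((‖ξ‖ ^ 2 + lam : ℝ) : ℂ))

/-- Resolvent-regularization `u_λ = √(sin(πs)/π) (-Δ+λ)⁻¹ u`. -/
def reg {d : ℕ} (s lam : ℝ) (f : Ed d → ℂ) : Ed d → ℂ :=
  fun x => ((Real.sqrt (Real.sin (Real.pi * s) / Real.pi) : ℝ) : ℂ) * resolv lam f x

/-- A function is radial if its value depends only on `|x|`. -/
def IsRadial {d : ℕ} (f : Ed d → ℂ) : Prop :=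
  ∀ x y : Ed d, ‖x‖ = ‖y‖ → f x = f y

/-- Homogeneous Sobolev norm `‖f‖_{Ḣ^s} = (2π)^{-d/2} ‖ |ξ|^s 𝓕f ‖_{L²}`. -/
def HdotNorm {d : ℕ} (s : ℝ) (f : Ed d → ℂ) : ℝ :=
  (2 * Real.pi) ^ (-(d : ℝ) / 2) *
    (eLpNorm (fun ξ : Ed d => ((‖ξ‖ ^ s : ℝ) : ℂ) * FT f ξ) 2 volume).toReal

/-- Inhomogeneous Sobolev norm `‖f‖_{H^s}² = ‖f‖_{L²}² + ‖f‖_{Ḣ^s}²`. -/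
def HNorm {d : ℕ} (s : ℝ) (f : Ed d → ℂ) : ℝ :=
  Real.sqrt ((eLpNorm f 2 volume).toReal ^ 2 + HdotNorm s f ^ 2)

/-- Mixed space-time norm `L^q_t L^r_x (ℝ × ℝ^d)`. -/
def mixedNorm {d : ℕ} (q r : ℝ≥0∞) (F : ℝ → Ed d → ℂ) : ℝ≥0∞ :=
  eLpNorm (fun t => (eLpNorm (F t) r volume).toReal) q volume

/-- Partial derivative `∂_j` of a complex-valued function. -/
def pd {d : ℕ} (j : Fin d) (f : Ed d → ℂ) (x : Ed d) : ℂ :=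
  fderiv ℝ f x (EuclideanSpace.single j 1)

/-- Partial derivative `∂_j` of a real-valued function. -/
def pdR {d : ℕ} (j : Fin d) (f : Ed d → ℝ) (x : Ed d) : ℝ :=
  fderiv ℝ f x (EuclideanSpace.single j 1)

/-- Laplacian of a real-valued function. -/
def lapR {d : ℕ} (f : Ed d → ℝ) : Ed d → ℝ :=
  fun x => ∑ j : Fin d, pdR j (pdR j f) x

/-- Rescaling `χ_R(x) = χ(x/R)`. -/
def chiR {d : ℕ} (χ : Ed d → ℝ) (R : ℝ) : Ed d → ℝ :=
  fun x => χ (R⁻¹ • x)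


/-- Squared `H^{1/2}` norm `(2π)^{-d} ∫ (1+|ξ|²)^{1/2} |𝓕u(ξ)|² dξ`. -/
def H12sq {d : ℕ} (f : Ed d → ℂ) : ℝ :=
  (2 * Real.pi) ^ (-(d : ℝ)) * ∫ ξ : Ed d, (1 + ‖ξ‖ ^ 2) ^ ((1 : ℝ)/2) * ‖FT f ξ‖ ^ 2

section Oscillatory

open scoped ContDiff

variable {ι E : Type*} [NormedAddCommGroup E] [NormedSpace ℝ E]

/-- A family of smooth real functions whose derivatives of each order are bounded, uniformly over
the family. -/
def UniformlySmooth (a : ι → E → ℝ) : Prop :=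
  (∀ i, ContDiff ℝ ∞ (a i)) ∧ ∀ n : ℕ, ∃ C : ℝ, ∀ i x, ‖iteratedFDeriv ℝ n (a i) x‖ ≤ C

lemma natCast_le_infty (n : ℕ) : (n : WithTop ℕ∞) ≤ (∞ : WithTop ℕ∞) := by
  exact_mod_cast le_top

lemma UniformlySmooth.exists_bound {a : ι → E → ℝ} (ha : UniformlySmooth a) (n : ℕ) :
    ∃ D : ℝ, 1 ≤ D ∧ ∀ m ≤ n, ∀ i x, ‖iteratedFDeriv ℝ m (a i) x‖ ≤ D := by
  choose C hC using ha.2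
  refine ⟨1 + ∑ m ∈ Finset.range (n + 1), |C m|, ?_, fun m hm i x => ?_⟩
  · have := Finset.sum_nonneg (s := Finset.range (n + 1)) (fun m _ => abs_nonneg (C m))
    linarith
  · have h1 : |C m| ≤ ∑ m ∈ Finset.range (n + 1), |C m| :=
      Finset.single_le_sum (f := fun m => |C m|) (fun m _ => abs_nonneg (C m))
        (Finset.mem_range.2 (by omega))
    have h2 := hC m i x
    have h3 := le_abs_self (C m)
    linarith

lemma UniformlySmooth.mul {a b : ι → E → ℝ} (ha : UniformlySmooth a) (hb : UniformlySmooth b) :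
    UniformlySmooth (fun i x => a i x * b i x) := by
  refine ⟨fun i => (ha.1 i).mul (hb.1 i), fun n => ?_⟩
  obtain ⟨A, hA1, hA⟩ := ha.exists_bound n
  obtain ⟨B, hB1, hB⟩ := hb.exists_bound n
  refine ⟨∑ j ∈ Finset.range (n + 1), (n.choose j : ℝ) * A * B, fun i x => ?_⟩
  refine (norm_iteratedFDeriv_mul_le (ha.1 i) (hb.1 i) x (natCast_le_infty n)).trans ?_
  refine Finset.sum_le_sum fun j hj => ?_
  have hj' : j ≤ n := by have := Finset.mem_range.1 hj; omega
  gcongr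
  · exact hA j hj' i x
  · exact hB _ (by omega) i x

lemma UniformlySmooth.fderiv_apply {a : ι → E → ℝ} (ha : UniformlySmooth a) {e : ι → E}
    (he : ∀ i, ‖e i‖ ≤ 1) : UniformlySmooth (fun i x => fderiv ℝ (a i) x (e i)) := by
  refine ⟨fun i => ((ha.1 i).fderiv_right (m := ∞) le_rfl).clm_apply contDiff_const, fun n => ?_⟩
  obtain ⟨C, hC⟩ := ha.2 (n + 1)
  refine ⟨C, fun i x => ?_⟩
  refine (norm_iteratedFDeriv_clm_apply_const (N := ∞)
    ((ha.1 i).fderiv_right (m := ∞) le_rfl).contDiffAt (natCast_le_infty n)).trans ?_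
  rw [norm_iteratedFDeriv_fderiv]
  calc _ ≤ 1 * ‖iteratedFDeriv ℝ (n + 1) (a i) x‖ := by gcongr; exact he i
    _ ≤ C := by rw [one_mul]; exact hC i x

lemma UniformlySmooth.add {a b : ι → E → ℝ} (ha : UniformlySmooth a) (hb : UniformlySmooth b) :
    UniformlySmooth (fun i x => a i x + b i x) := by
  refine ⟨fun i => (ha.1 i).add (hb.1 i), fun n => ?_⟩
  obtain ⟨A, hA⟩ := ha.2 n
  obtain ⟨B, hB⟩ := hb.2 n
  refine ⟨A + B, fun i x => ?_⟩
  rw [fun_iteratedFDeriv_add_apply ((ha.1 i).of_le (natCast_le_infty n)).contDiffAt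
    ((hb.1 i).of_le (natCast_le_infty n)).contDiffAt]
  exact (norm_add_le _ _).trans (add_le_add (hA i x) (hB i x))

lemma uniformlySmooth_const (c : ℝ) : UniformlySmooth (fun (_ : ι) (_ : E) => c) := by
  refine ⟨fun i => contDiff_const, fun n => ⟨|c|, fun i x => ?_⟩⟩
  rcases n with _ | n
  · simp
  · rw [iteratedFDeriv_succ_const]; simp

lemma uniformlySmooth_of_hasCompactSupport {g : E → ℝ} (hg : ContDiff ℝ ∞ g)
    (hc : HasCompactSupport g) : UniformlySmooth (fun _ : ι => g) := by
  refine ⟨fun i => hg, fun n => ?_⟩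
  obtain ⟨C, hC⟩ :=
    (hg.continuous_iteratedFDeriv (natCast_le_infty n)).bounded_above_of_compact_support
      (hc.iteratedFDeriv n)
  exact ⟨C, fun i x => hC x⟩

lemma UniformlySmooth.translate {a : ι → E → ℝ} (ha : UniformlySmooth a) (h : ι → E) :
    UniformlySmooth (fun i x => a i (x + h i)) := by
  refine ⟨fun i => (ha.1 i).comp (contDiff_id.add contDiff_const), fun n => ?_⟩
  obtain ⟨C, hC⟩ := ha.2 n
  refine ⟨C, fun i x => ?_⟩
  rw [iteratedFDeriv_comp_add_right]
  exact hC i _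

lemma UniformlySmooth.inv {q : ι → E → ℝ} (hq : UniformlySmooth q) {c : ℝ} (hc : 0 < c)
    (hcq : ∀ i x, c ≤ q i x) : UniformlySmooth (fun i x => (q i x)⁻¹) := by
  refine ⟨fun i => (hq.1 i).inv fun x => (hc.trans_le (hcq i x)).ne', fun n => ?_⟩
  obtain ⟨D, hD1, hD⟩ := hq.exists_bound n
  have hsub : ∀ y ∈ Set.Icc c (c + D), y ≠ 0 := fun y hy => (hc.trans_le hy.1).ne'
  have hu : UniqueDiffOn ℝ (Set.Icc c (c + D)) := uniqueDiffOn_Icc (by linarith)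
  have hinv : ContDiffOn ℝ ∞ (fun y : ℝ => y⁻¹) (Set.Icc c (c + D)) :=
    contDiffOn_id.inv hsub
  have hb : ∀ m : ℕ, ∃ B : ℝ, ∀ y ∈ Set.Icc c (c + D),
      ‖iteratedFDerivWithin ℝ m (fun y : ℝ => y⁻¹) (Set.Icc c (c + D)) y‖ ≤ B := fun m =>
    isCompact_Icc.exists_bound_of_continuousOn
      (hinv.continuousOn_iteratedFDerivWithin (natCast_le_infty m) hu)
  choose B hB using hb
  have hmem : ∀ i x, q i x ∈ Set.Icc c (c + D) := fun i x => by
    refine ⟨hcq i x, ?_⟩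
    have := hD 0 (Nat.zero_le n) i x
    rw [norm_iteratedFDeriv_zero] at this
    have := (Real.le_norm_self _).trans this
    linarith
  refine ⟨n.factorial * (∑ m ∈ Finset.range (n + 1), |B m|) * D ^ n, fun i x => ?_⟩
  refine norm_iteratedFDeriv_comp_le' (g := fun y : ℝ => y⁻¹) (f := q i) (t := Set.Icc c (c + D))
    (by rintro _ ⟨x, rfl⟩; exact hmem i x) hu hinv (hq.1 i) (natCast_le_infty n) x ?_ ?_
  · intro m hm
    refine (hB m _ (hmem i x)).trans ((le_abs_self _).trans ?_)
    exact Finset.single_le_sum (f := fun m => |B m|) (fun m _ => abs_nonneg (B m))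
      (Finset.mem_range.2 (by omega))
  · intro m hm hmn
    exact (hD m hmn i x).trans (le_self_pow₀ hD1 (by omega))

/-- Difference quotients of a smooth compactly supported function form a uniformly smooth family. -/
lemma uniformlySmooth_diffQuot {g : E → ℝ} (hg : ContDiff ℝ ∞ g) (hc : HasCompactSupport g)
    (h : ι → E) : UniformlySmooth (fun i x => ‖h i‖⁻¹ * (g (x + h i) - g x)) := by
  have hsm : ∀ i, ContDiff ℝ ∞ (fun x => g (x + h i)) := fun i =>
    hg.comp (contDiff_id.add contDiff_const)
  refine ⟨fun i => contDiff_const.mul ((hsm i).sub hg), fun n => ?_⟩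
  obtain ⟨C, hC⟩ := (uniformlySmooth_of_hasCompactSupport (ι := Unit) hg hc).2 (n + 1)
  refine ⟨|C|, fun i x => ?_⟩
  have e1 : iteratedFDeriv ℝ n (fun x => ‖h i‖⁻¹ * (g (x + h i) - g x)) x =
      ‖h i‖⁻¹ • (iteratedFDeriv ℝ n g (x + h i) - iteratedFDeriv ℝ n g x) := by
    have hd : ContDiff ℝ n (fun x => g (x + h i) - g x) :=
      ((hsm i).sub hg).of_le (natCast_le_infty n)
    have := iteratedFDeriv_const_smul_apply' (a := ‖h i‖⁻¹) (x := x) hd.contDiffAt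
    simp only [smul_eq_mul] at this
    rw [this, fun_iteratedFDeriv_sub_apply ((hsm i).of_le (natCast_le_infty n)).contDiffAt
      (hg.of_le (natCast_le_infty n)).contDiffAt, iteratedFDeriv_comp_add_right]
  have e2 : ‖iteratedFDeriv ℝ n g (x + h i) - iteratedFDeriv ℝ n g x‖ ≤ |C| * ‖h i‖ := by
    have := Convex.norm_image_sub_le_of_norm_fderiv_le (𝕜 := ℝ) (f := iteratedFDeriv ℝ n g)
      (s := Set.univ) (x := x) (y := x + h i) (C := |C|)
      (fun y _ => (hg.differentiable_iteratedFDeriv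
        (by exact_mod_cast WithTop.coe_lt_top _)).differentiableAt)
      (fun y _ => by
        rw [norm_fderiv_iteratedFDeriv]
        exact (hC () y).trans (le_abs_self C)) convex_univ (Set.mem_univ _) (Set.mem_univ _)
    simpa using this
  rw [e1, norm_smul, norm_inv, norm_norm]
  rcases eq_or_ne (‖h i‖) 0 with h0 | h0
  · simp [h0]
  · have hp : 0 < ‖h i‖ := lt_of_le_of_ne (norm_nonneg _) (Ne.symm h0)
    calc _ ≤ ‖h i‖⁻¹ * (|C| * ‖h i‖) := by gcongr
      _ = |C| := by field_simp

end Oscillatory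

section OscillatoryIntegral

open scoped ContDiff

variable {ι E : Type*} [NormedAddCommGroup E] [NormedSpace ℝ E] [FiniteDimensional ℝ E]
  [MeasurableSpace E] [BorelSpace E] (μ : Measure E) [μ.IsAddHaarMeasure]

/-- The oscillatory integral `∫ e^{i s P} a`. -/
def oscInt (P a : E → ℝ) (s : ℝ) : ℂ := ∫ x, exp (I * (s * P x : ℝ)) * (a x : ℂ) ∂μ

lemma oscInt_fderiv {P b : E → ℝ} (hP : ContDiff ℝ ∞ P) (hb : ContDiff ℝ ∞ b)
    (hc : HasCompactSupport b) (e : E) (s : ℝ) :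
    oscInt μ P (fun x => fderiv ℝ b x e) s =
      -(I * s) * oscInt μ P (fun x => b x * fderiv ℝ P x e) s := by
  have hPd : Differentiable ℝ P := hP.differentiable (by simp)
  have hbd : Differentiable ℝ b := hb.differentiable (by simp)
  have hP' : Continuous fun x => fderiv ℝ P x e :=
    (hP.continuous_fderiv (by simp)).clm_apply continuous_const
  have hb' : Continuous fun x => fderiv ℝ b x e :=
    (hb.continuous_fderiv (by simp)).clm_apply continuous_const
  have hF : ∀ x, HasFDerivAt (fun x => exp (I * (s * P x : ℝ)))
      (exp (I * (s * P x : ℝ)) • (I • ofRealCLM.comp (s • fderiv ℝ P x))) x := fun x =>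
    ((ofRealCLM.hasFDerivAt.comp x ((hPd x).hasFDerivAt.const_mul s)).const_mul I).cexp
  have hG : ∀ x, HasFDerivAt (fun x => (b x : ℂ)) (ofRealCLM.comp (fderiv ℝ b x)) x := fun x =>
    ofRealCLM.hasFDerivAt.comp x (hbd x).hasFDerivAt
  have hFc : Continuous fun x => exp (I * (s * P x : ℝ)) := by
    have := hP.continuous
    fun_prop
  have hcC : HasCompactSupport fun x => (b x : ℂ) := hc.comp_left (g := ofReal) ofReal_zero
  have hcC' : HasCompactSupport fun x => ((fderiv ℝ b x e : ℝ) : ℂ) :=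
    (hc.fderiv_apply ℝ e).comp_left (g := ofReal) ofReal_zero
  have hbC : Continuous fun x => (b x : ℂ) := continuous_ofReal.comp hb.continuous
  have key := integral_mul_fderiv_eq_neg_fderiv_mul_of_integrable (μ := μ)
    (f := fun x => exp (I * (s * P x : ℝ))) (g := fun x => (b x : ℂ)) (v := e) ?_ ?_ ?_
    (fun x _ => (hF x).differentiableAt) (fun x _ => (hG x).differentiableAt)
  · simp only [(hF _).fderiv, (hG _).fderiv] at key
    simp only [oscInt]
    refine (Eq.trans ?_ key).trans ?_
    · rfl
    · rw [neg_mul, ← integral_const_mul]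
      congr 2
      ext x
      simp
      ring
  · simp only [(hF _).fderiv]
    refine Continuous.integrable_of_hasCompactSupport ?_ hcC.mul_left
    refine Continuous.mul ?_ hbC
    simp only [smul_apply, ContinuousLinearMap.comp_apply, ofRealCLM_apply, smul_eq_mul]
    fun_prop
  · simp only [(hG _).fderiv]
    refine Continuous.integrable_of_hasCompactSupport ?_ ?_
    · exact hFc.mul (continuous_ofReal.comp hb')
    · exact hcC'.mul_left
  · exact (hFc.mul hbC).integrable_of_hasCompactSupport hcC.mul_left

lemma norm_oscInt_le {P a : E → ℝ} {K : Set E} (hK : IsCompact K) (ha : tsupport a ⊆ K) {C : ℝ}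
    (hC : ∀ x, ‖a x‖ ≤ C) (s : ℝ) : ‖oscInt μ P a s‖ ≤ C * μ.real K := by
  have h : oscInt μ P a s = ∫ x in K, exp (I * (s * P x : ℝ)) * (a x : ℂ) ∂μ := by
    refine (setIntegral_eq_integral_of_forall_compl_eq_zero fun x hx => ?_).symm
    rw [image_eq_zero_of_notMem_tsupport fun h => hx (ha h)]
    simp
  rw [h]
  refine norm_setIntegral_le_of_norm_le_const hK.measure_lt_top fun x _ => ?_
  rw [norm_mul, mul_comm I, norm_exp_ofReal_mul_I, one_mul, norm_real]
  exact hC x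

/-- Rapid decay of oscillatory integrals with non-stationary phase, uniformly over families. -/
theorem exists_oscInt_decay {P w : ι → E → ℝ} {e : ι → E} (hP : ∀ i, ContDiff ℝ ∞ (P i))
    (hw : UniformlySmooth w) (he : ∀ i, ‖e i‖ ≤ 1) {K : Set E} (hK : IsCompact K) (N : ℕ) :
    ∀ a : ι → E → ℝ, UniformlySmooth a → (∀ i, tsupport (a i) ⊆ K) →
      (∀ i, ∀ x ∈ tsupport (a i), w i x * fderiv ℝ (P i) x (e i) = 1) →
      ∃ C : ℝ, ∀ i s, |s| ^ N * ‖oscInt μ (P i) (a i) s‖ ≤ C := by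
  induction N with
  | zero =>
    intro a ha hsupp _
    obtain ⟨C, hC⟩ := ha.2 0
    refine ⟨C * μ.real K, fun i s => ?_⟩
    rw [pow_zero, one_mul]
    exact norm_oscInt_le μ hK (hsupp i) (fun x => by simpa using hC i x) s
  | succ N ih =>
    intro a ha hsupp hwP
    have hwa := hw.mul ha
    have hts : ∀ i, tsupport (fun x => fderiv ℝ (fun y => w i y * a i y) x (e i)) ⊆
        tsupport (a i) := fun i =>
      (tsupport_fderiv_apply_subset ℝ (e i)).trans (tsupport_mul_subset_right (f := w i) (g := a i))
    obtain ⟨C, hC⟩ := ih _ (hwa.fderiv_apply he) (fun i => (hts i).trans (hsupp i))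
      (fun i x hx => hwP i x (hts i hx))
    refine ⟨C, fun i s => (le_of_eq ?_).trans (hC i s)⟩
    have hcs : HasCompactSupport (fun y => w i y * a i y) :=
      hK.of_isClosed_subset (isClosed_tsupport _)
        ((tsupport_mul_subset_right (f := w i) (g := a i)).trans (hsupp i))
    rw [oscInt_fderiv μ (hP i) (hwa.1 i) hcs]
    have : (fun x => w i x * a i x * fderiv ℝ (P i) x (e i)) = a i := by
      ext x
      by_cases hx : x ∈ tsupport (a i)
      · rw [mul_right_comm, hwP i x hx, one_mul]
      · rw [image_eq_zero_of_notMem_tsupport hx]; simp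
    rw [this, norm_mul, norm_neg, norm_mul, norm_I, one_mul, norm_real, Real.norm_eq_abs]
    ring

end OscillatoryIntegral

section Phase

open scoped ContDiff

variable {E : Type*} [NormedAddCommGroup E] [InnerProductSpace ℝ E]

lemma monotoneOn_rpow_sub_mul {p R : ℝ} (hp : 1 < p) (hp2 : p ≤ 2) :
    MonotoneOn (fun z : ℝ => z ^ (p - 1) - (p - 1) * R ^ (p - 2) * z) (Set.Ioc 0 R) := by
  have hd : ∀ z : ℝ, 0 < z → HasDerivAt (fun z : ℝ => z ^ (p - 1) - (p - 1) * R ^ (p - 2) * z)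
      ((p - 1) * z ^ (p - 1 - 1) - (p - 1) * R ^ (p - 2) * 1) z := fun z hz =>
    (Real.hasDerivAt_rpow_const (Or.inl hz.ne')).sub ((hasDerivAt_id z).const_mul _)
  refine monotoneOn_of_deriv_nonneg (convex_Ioc 0 R)
    (fun z hz => (hd z hz.1).continuousAt.continuousWithinAt)
    (fun z hz => ?_) (fun z hz => ?_)
  · rw [interior_Ioc] at hz
    exact (hd z hz.1).differentiableAt.differentiableWithinAt
  · rw [interior_Ioc] at hz
    rw [(hd z hz.1).deriv, show p - 1 - 1 = p - 2 by ring, mul_one, ← mul_sub]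
    refine mul_nonneg (by linarith) (sub_nonneg.2 ?_)
    exact Real.rpow_le_rpow_of_nonpos hz.1 hz.2.le (by linarith)

/-- Strong monotonicity of the gradient of `‖x‖ ^ p / p` on balls, for `1 < p ≤ 2`. -/
lemma norm_rpow_gradient_strongly_monotone {p R : ℝ} (hp : 1 < p) (hp2 : p ≤ 2) {x y : E}
    (hx : x ≠ 0) (hy : y ≠ 0) (hxR : ‖x‖ ≤ R) (hyR : ‖y‖ ≤ R) :
    (p - 1) * R ^ (p - 2) * ‖y - x‖ ^ 2 ≤
      ‖y‖ ^ (p - 2) * ⟪y, y - x⟫ - ‖x‖ ^ (p - 2) * ⟪x, y - x⟫ := by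
  have ha : 0 < ‖x‖ := norm_pos_iff.2 hx
  have hb : 0 < ‖y‖ := norm_pos_iff.2 hy
  have hR : 0 < R := ha.trans_le hxR
  have hm := monotoneOn_rpow_sub_mul (R := R) hp hp2
  have hRp : 0 < R ^ (p - 2) := Real.rpow_pos_of_pos hR _
  have hA : R ^ (p - 2) ≤ ‖x‖ ^ (p - 2) := Real.rpow_le_rpow_of_nonpos ha hxR (by linarith)
  have hB : R ^ (p - 2) ≤ ‖y‖ ^ (p - 2) := Real.rpow_le_rpow_of_nonpos hb hyR (by linarith)
  have hca : ‖x‖ ^ (p - 1) = ‖x‖ ^ (p - 2) * ‖x‖ := by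
    rw [← Real.rpow_add_one ha.ne']; congr 1; ring
  have hcb : ‖y‖ ^ (p - 1) = ‖y‖ ^ (p - 2) * ‖y‖ := by
    rw [← Real.rpow_add_one hb.ne']; congr 1; ring
  have hcR : (p - 1) * R ^ (p - 2) ≤ R ^ (p - 2) := by nlinarith
  have hs : ⟪y, x⟫ ≤ ‖y‖ * ‖x‖ := real_inner_le_norm y x
  have hprod : 0 ≤ ((‖y‖ ^ (p - 2) - (p - 1) * R ^ (p - 2)) * ‖y‖
      - (‖x‖ ^ (p - 2) - (p - 1) * R ^ (p - 2)) * ‖x‖) * (‖y‖ - ‖x‖) := by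
    rcases le_total ‖x‖ ‖y‖ with h | h
    · have := hm ⟨ha, hxR⟩ ⟨hb, hyR⟩ h
      simp only [hca, hcb] at this
      exact mul_nonneg (by linarith) (by linarith)
    · have := hm ⟨hb, hyR⟩ ⟨ha, hxR⟩ h
      simp only [hca, hcb] at this
      exact mul_nonneg_of_nonpos_of_nonpos (by linarith) (by linarith)
  have e1 : ‖y - x‖ ^ 2 = ‖y‖ ^ 2 - 2 * ⟪y, x⟫ + ‖x‖ ^ 2 := norm_sub_sq_real y x
  rw [e1, inner_sub_right, inner_sub_right, real_inner_self_eq_norm_sq, real_inner_self_eq_norm_sq,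
    real_inner_comm y x]
  have hsum : 0 ≤ (‖y‖ ^ (p - 2) + ‖x‖ ^ (p - 2) - 2 * ((p - 1) * R ^ (p - 2))) *
      (‖y‖ * ‖x‖ - ⟪y, x⟫) := mul_nonneg (by linarith) (by linarith)
  nlinarith

end Phase

section Cutoff

open scoped ContDiff Topology

variable {E : Type*} [NormedAddCommGroup E] [InnerProductSpace ℝ E] [FiniteDimensional ℝ E]

/-- The closed annulus `{a ≤ ‖x‖ ≤ b}`. -/
def annulus (E : Type*) [NormedAddCommGroup E] (a b : ℝ) : Set E := {x | a ≤ ‖x‖ ∧ ‖x‖ ≤ b}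

lemma isClosed_annulus (a b : ℝ) : IsClosed (annulus E a b) :=
  (isClosed_le continuous_const continuous_norm).inter
    (isClosed_le continuous_norm continuous_const)

lemma isCompact_annulus (a b : ℝ) : IsCompact (annulus E a b) :=
  (isCompact_closedBall (0 : E) b).of_isClosed_subset (isClosed_annulus a b) fun x hx => by
    simpa using hx.2

lemma exists_annulus_cutoff {a b a' b' : ℝ} (ha : a' < a) (hb : b < b') :
    ∃ χ : E → ℝ, ContDiff ℝ ∞ χ ∧ (∀ x ∈ annulus E a b, ∀ᶠ y in 𝓝 x, χ y = 1) ∧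
      (∀ x ∉ annulus E a' b', χ x = 0) ∧ ∀ x, χ x ∈ Set.Icc (0 : ℝ) 1 := by
  obtain ⟨f, h1, h0, h⟩ := exists_contMDiffMap_one_nhds_of_subset_interior (n := ⊤)
    (modelWithCornersSelf ℝ E) (s := annulus E a b) (t := annulus E a' b')
    (isClosed_annulus a b) (by
      have ho : IsOpen {x : E | a' < ‖x‖ ∧ ‖x‖ < b'} :=
        (isOpen_lt continuous_const continuous_norm).inter
          (isOpen_lt continuous_norm continuous_const)
      refine subset_trans (fun x hx => ?_) (ho.subset_interior_iff.2 fun x hx => ⟨hx.1.le, hx.2.le⟩)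
      exact ⟨ha.trans_le hx.1, hx.2.trans_lt hb⟩)
  exact ⟨f, f.contMDiff.contDiff, fun x hx => (eventually_nhdsSet_iff_forall.1 h1) x hx,
    h0, h⟩

lemma tsupport_subset_annulus {χ : E → ℝ} {a b : ℝ} (h : ∀ x ∉ annulus E a b, χ x = 0) :
    tsupport χ ⊆ annulus E a b :=
  closure_minimal (fun x hx => by_contra fun hn => hx (h x hn)) (isClosed_annulus a b)

lemma hasCompactSupport_of_annulus {χ : E → ℝ} {a b : ℝ} (h : ∀ x ∉ annulus E a b, χ x = 0) :
    HasCompactSupport χ :=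
  (isCompact_annulus a b).of_isClosed_subset (isClosed_tsupport _) (tsupport_subset_annulus h)

lemma contDiff_cutoff_mul_norm_rpow {χ : E → ℝ} (hχ : ContDiff ℝ ∞ χ) {a b : ℝ} (ha : 0 < a)
    (h : ∀ x ∉ annulus E a b, χ x = 0) (p : ℝ) : ContDiff ℝ ∞ (fun x => χ x * ‖x‖ ^ p) := by
  rw [contDiff_iff_contDiffAt]
  intro x
  rcases eq_or_ne x 0 with rfl | hx
  · refine (contDiffAt_const (c := (0 : ℝ))).congr_of_eventuallyEq ?_
    filter_upwards [Metric.ball_mem_nhds (0 : E) ha] with y hy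
    rw [h y fun hy' => ?_, zero_mul]
    have : ‖y‖ < a := by simpa using hy
    exact absurd hy'.1 (not_le.2 this)
  · exact hχ.contDiffAt.mul ((contDiffAt_norm ℝ hx).rpow_const_of_ne (norm_ne_zero_iff.2 hx))

end Cutoff

section Dispersive

open scoped ContDiff Topology ComplexConjugate

variable {E : Type*} [NormedAddCommGroup E] [InnerProductSpace ℝ E] [FiniteDimensional ℝ E]
  [MeasurableSpace E] [BorelSpace E]

lemma norm_integral_sq_le {u : E → ℂ} (hu : Integrable u) {B : E → ℝ} (hB : Integrable B)
    (h : ∀ᵐ y : E, ‖∫ x, u (x + y) * conj (u x)‖ ≤ B y) : ‖∫ x, u x‖ ^ 2 ≤ ∫ y, B y := by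
  have hcu : Integrable fun x => conj (u x) :=
    (LinearIsometryEquiv.integrable_comp_iff conjLIE).2 hu
  have hI : Integrable (fun z : E × E => u (z.1 + z.2) * conj (u z.1)) (volume.prod volume) := by
    have h0 : Integrable (fun z : E × E => conj (u z.1) * u z.2) (volume.prod volume) :=
      hcu.mul_prod hu
    have := (measurePreserving_prod_add (volume : Measure E) (volume : Measure E)).integrable_comp
      h0.aestronglyMeasurable |>.2 h0
    refine this.congr (Filter.Eventually.of_forall fun z => ?_)
    simp [mul_comm]
  have e : ((‖∫ x, u x‖ ^ 2 : ℝ) : ℂ) = ∫ y, ∫ x, u (x + y) * conj (u x) := by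
    rw [← integral_integral_swap (f := fun x y => u (x + y) * conj (u x)) hI]
    simp only [integral_mul_const, integral_add_left_eq_self u]
    rw [integral_const_mul, integral_conj, mul_conj, normSq_eq_norm_sq]
  calc ‖∫ x, u x‖ ^ 2 = ‖((‖∫ x, u x‖ ^ 2 : ℝ) : ℂ)‖ := by
        rw [norm_real, Real.norm_of_nonneg (by positivity)]
    _ ≤ ∫ y, B y := by rw [e]; exact norm_integral_le_of_norm_le hB h

lemma fderiv_cutoff_mul_norm_rpow {χ : E → ℝ} {p : ℝ} (hp : 1 < p) {x : E}
    (h : ∀ᶠ y in 𝓝 x, χ y = 1) (v : E) :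
    fderiv ℝ (fun y => χ y * ‖y‖ ^ p) x v = p * (‖x‖ ^ (p - 2) * ⟪x, v⟫) := by
  have : (fun y => χ y * ‖y‖ ^ p) =ᶠ[𝓝 x] fun y => ‖y‖ ^ p := by
    filter_upwards [h] with y hy
    rw [hy, one_mul]
  rw [this.fderiv_eq, (hasFDerivAt_norm_rpow x hp).fderiv]
  simp [mul_assoc]

/-- Decay of the autocorrelation integrals of the localized phase `‖ξ‖ ^ p`. -/
theorem exists_autocorrelation_decay {p : ℝ} (hp : 1 < p) (hp2 : p ≤ 2) {g ψ χ χ' : E → ℝ}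
    (hψ : ContDiff ℝ ∞ ψ) (hχ : ContDiff ℝ ∞ χ) (hχ' : ContDiff ℝ ∞ χ')
    (hψ0 : ∀ x ∉ annulus E (1/4) 4, ψ x = 0)
    (hχ1 : ∀ x ∈ annulus E (1/4) 4, ∀ᶠ y in 𝓝 x, χ y = 1)
    (hχ0 : ∀ x ∉ annulus E (1/8) 8, χ x = 0) (hχI : ∀ x, χ x ∈ Set.Icc (0 : ℝ) 1)
    (hχ1' : ∀ x ∈ annulus E (1/8) 8, ∀ᶠ y in 𝓝 x, χ' y = 1)
    (hχ0' : ∀ x ∉ annulus E (1/16) 16, χ' x = 0) (hg : g = fun x => χ' x * ‖x‖ ^ p) (N : ℕ) :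
    ∃ C : ℝ, ∀ h : E, h ≠ 0 → ∀ t : ℝ, (|t| * ‖h‖) ^ N *
      ‖∫ x, exp (I * (t * (g (x + h) - g x) : ℝ)) * (ψ x * ψ (x + h) : ℝ)‖ ≤ C := by
  have hgs : ContDiff ℝ ∞ g := hg ▸ contDiff_cutoff_mul_norm_rpow hχ' (by norm_num) hχ0' p
  have hgc : HasCompactSupport g :=
    hg ▸ (hasCompactSupport_of_annulus hχ0').mul_right
  let ι := {h : E // h ≠ 0}
  let P : ι → E → ℝ := fun h x => ‖h.1‖⁻¹ * (g (x + h.1) - g x)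
  let e : ι → E := fun h => ‖h.1‖⁻¹ • h.1
  have he : ∀ h, ‖e h‖ ≤ 1 := fun h => by
    simp [e, norm_smul, inv_mul_cancel₀ (norm_ne_zero_iff.2 h.2)]
  have hP : UniformlySmooth P := uniformlySmooth_diffQuot hgs hgc _
  let Q : ι → E → ℝ := fun h x => fderiv ℝ (P h) x (e h)
  have hQ : UniformlySmooth Q := hP.fderiv_apply he
  let c : ℝ := p * ((p - 1) * 8 ^ (p - 2))
  have hc : 0 < c := by
    have : (0 : ℝ) < 8 ^ (p - 2) := Real.rpow_pos_of_pos (by norm_num) _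
    have : 0 < p - 1 := by linarith
    positivity
  have hne : ∀ x ∈ annulus E (1/8) 8, x ≠ 0 := by
    rintro x hx rfl
    have := hx.1
    norm_num at this
  have hQc : ∀ (h : ι) (x : E), x ∈ annulus E (1/8) 8 → x + h.1 ∈ annulus E (1/8) 8 →
      c ≤ Q h x := by
    intro h x hx hxh
    have hh : 0 < ‖h.1‖ := norm_pos_iff.2 h.2
    have hgd : Differentiable ℝ g := hgs.differentiable (by simp)
    have e1 : Q h x = ‖h.1‖⁻¹ * (fderiv ℝ g (x + h.1) (e h) - fderiv ℝ g x (e h)) := by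
      simp only [Q, P]
      rw [fderiv_const_mul (by fun_prop), fderiv_fun_sub (by fun_prop) (by fun_prop),
        fderiv_comp_add_right]
      simp
    have hm := norm_rpow_gradient_strongly_monotone hp hp2 (hne x hx) (hne _ hxh) hx.2 hxh.2
    rw [add_sub_cancel_left] at hm
    rw [e1, hg, fderiv_cutoff_mul_norm_rpow hp (hχ1' _ hx),
      fderiv_cutoff_mul_norm_rpow hp (hχ1' _ hxh)]
    simp only [e, inner_smul_right]
    have e2 : ‖h.1‖⁻¹ * (p * (‖x + h.1‖ ^ (p - 2) * (‖h.1‖⁻¹ * ⟪x + h.1, h.1⟫)) -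
        p * (‖x‖ ^ (p - 2) * (‖h.1‖⁻¹ * ⟪x, h.1⟫))) =
        p * (‖x + h.1‖ ^ (p - 2) * ⟪x + h.1, h.1⟫ - ‖x‖ ^ (p - 2) * ⟪x, h.1⟫) / ‖h.1‖ ^ 2 := by
      field_simp
    rw [e2, le_div_iff₀ (by positivity)]
    simp only [c]
    rw [mul_assoc]
    exact mul_le_mul_of_nonneg_left hm (by linarith)
  let θ : ι → E → ℝ := fun h x => χ x * χ (x + h.1)
  have hχu : UniformlySmooth (fun _ : ι => χ) :=
    uniformlySmooth_of_hasCompactSupport hχ (hasCompactSupport_of_annulus hχ0)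
  have hψu : UniformlySmooth (fun _ : ι => ψ) :=
    uniformlySmooth_of_hasCompactSupport hψ (hasCompactSupport_of_annulus hψ0)
  have hθ : UniformlySmooth θ := hχu.mul (hχu.translate fun h => h.1)
  let q : ι → E → ℝ := fun h x => θ h x * Q h x + (c + -c * θ h x)
  have hq : UniformlySmooth q :=
    (hθ.mul hQ).add ((uniformlySmooth_const c).add ((uniformlySmooth_const (-c)).mul hθ))
  have hqc : ∀ h x, c ≤ q h x := by
    intro h x
    have h0 : 0 ≤ θ h x := mul_nonneg (hχI _).1 (hχI _).1
    have : 0 ≤ θ h x * (Q h x - c) := by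
      rcases eq_or_ne (θ h x) 0 with hz | hz
      · simp [hz]
      · refine mul_nonneg h0 (sub_nonneg.2 (hQc h x ?_ ?_))
        · exact by_contra fun hn => hz (by simp [θ, hχ0 x hn])
        · exact by_contra fun hn => hz (by simp [θ, hχ0 _ hn])
    simp only [q]
    linarith
  let a : ι → E → ℝ := fun h x => ψ x * ψ (x + h.1)
  have ha : UniformlySmooth a := hψu.mul (hψu.translate fun h => h.1)
  have hsub : ∀ h, tsupport (a h) ⊆ annulus E (1/4) 4 := fun h =>
    (tsupport_mul_subset_left (f := ψ)).trans (tsupport_subset_annulus hψ0)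
  have hsub' : ∀ (h : ι), ∀ x ∈ tsupport (a h), x + h.1 ∈ annulus E (1/4) 4 := fun h =>
    closure_minimal (s := Function.support (a h)) (t := (fun x => x + h.1) ⁻¹' annulus E (1/4) 4)
      (fun x hx => by_contra fun hn => hx (by simp [a, hψ0 _ hn]))
      ((isClosed_annulus _ _).preimage (by fun_prop))
  have hmono : annulus E (1/4) 4 ⊆ annulus E (1/8) 8 := fun x hx =>
    ⟨by linarith [hx.1], by linarith [hx.2]⟩
  obtain ⟨C, hC⟩ := exists_oscInt_decay volume (w := fun h x => (q h x)⁻¹) hP.1 (hq.inv hc hqc) he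
    (isCompact_annulus (1/4) 4) N a ha hsub (fun h x hx => by
      have h1 : θ h x = 1 := by
        simp [θ, (hχ1 x (hsub h hx)).self_of_nhds, (hχ1 _ (hsub' h x hx)).self_of_nhds]
      have h2 : q h x = Q h x := by simp [q, h1]
      have h3 := hc.trans_le (hqc h x)
      rw [h2] at h3
      simp only [h2]
      exact inv_mul_cancel₀ h3.ne')
  refine ⟨C, fun h hh t => ?_⟩
  have := hC ⟨h, hh⟩ (t * ‖h‖)
  rw [abs_mul, abs_norm] at this
  refine (le_of_eq ?_).trans this
  congr 2
  simp only [oscInt, P, a]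
  congr 1
  ext x
  have : t * ‖h‖ * (‖h‖⁻¹ * (g (x + h) - g x)) = t * (g (x + h) - g x) := by
    have := norm_ne_zero_iff.2 hh
    field_simp
  rw [this]

/-- Frequency-localized dispersive estimate for the kernel with phase `‖ξ‖ ^ p`. -/
theorem exists_dispersive_kernel_bound [Nontrivial E] {p : ℝ} (hp : 1 < p) (hp2 : p ≤ 2) :
    ∃ ψ : E → ℝ, ContDiff ℝ ∞ ψ ∧ (∀ x ∈ annulus E (1/2) 2, ψ x = 1) ∧
      (∀ x ∉ annulus E (1/4) 4, ψ x = 0) ∧ (∀ x, ψ x ∈ Set.Icc (0 : ℝ) 1) ∧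
      ∃ C : ℝ, 0 < C ∧ ∀ t : ℝ, t ≠ 0 → ∀ x : E,
        ‖∫ ξ : E, exp (I * (⟪x, ξ⟫ - t * ‖ξ‖ ^ p : ℝ)) * (ψ ξ : ℂ)‖ ≤
          C * |t| ^ (-((Module.finrank ℝ E : ℝ) / 2)) := by
  obtain ⟨ψ, hψ, hψ1, hψ0, hψI⟩ := exists_annulus_cutoff (E := E) (a := 1/2) (b := 2) (a' := 1/4)
    (b' := 4) (by norm_num) (by norm_num)
  obtain ⟨χ, hχ, hχ1, hχ0, hχI⟩ := exists_annulus_cutoff (E := E) (a := 1/4) (b := 4) (a' := 1/8)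
    (b' := 8) (by norm_num) (by norm_num)
  obtain ⟨χ', hχ', hχ1', hχ0', hχI'⟩ := exists_annulus_cutoff (E := E) (a := 1/8) (b := 8)
    (a' := 1/16) (b' := 16) (by norm_num) (by norm_num)
  refine ⟨ψ, hψ, fun x hx => (hψ1 x hx).self_of_nhds, hψ0, hψI, ?_⟩
  set g : E → ℝ := fun x => χ' x * ‖x‖ ^ p with hg
  have hgs : ContDiff ℝ ∞ g := contDiff_cutoff_mul_norm_rpow hχ' (by norm_num) hχ0' p
  obtain ⟨C₀, hC₀⟩ := exists_autocorrelation_decay hp hp2 hψ hχ hχ' hψ0 hχ1 hχ0 hχI hχ1' hχ0' hg 0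
  obtain ⟨C₁, hC₁⟩ := exists_autocorrelation_decay hp hp2 hψ hχ hχ' hψ0 hχ1 hχ0 hχI hχ1' hχ0' hg
    (Module.finrank ℝ E + 1)
  set n := Module.finrank ℝ E with hn
  have hint : Integrable fun y : E => (1 + ‖y‖) ^ (-(n + 1 : ℝ)) :=
    integrable_one_add_norm (by rw [← hn]; linarith)
  set M := ∫ y : E, (1 + ‖y‖) ^ (-(n + 1 : ℝ)) with hM
  have hM0 : 0 ≤ M := integral_nonneg fun y => by positivity
  set D := 2 ^ n * (|C₀| + |C₁|) with hD
  have hD0 : 0 ≤ D := by positivity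
  refine ⟨Real.sqrt (D * M) + 1, by positivity, fun t ht x => ?_⟩
  have htp : 0 < |t| := abs_pos.2 ht
  set u : E → ℂ := fun ξ => exp (I * (⟪x, ξ⟫ - t * g ξ : ℝ)) * (ψ ξ : ℂ) with hu
  have hug : ∀ ξ, exp (I * (⟪x, ξ⟫ - t * ‖ξ‖ ^ p : ℝ)) * (ψ ξ : ℂ) = u ξ := fun ξ => by
    by_cases hξ : ξ ∈ annulus E (1/8) 8
    · simp only [hu, hg, (hχ1' ξ hξ).self_of_nhds, one_mul]
    · have : ψ ξ = 0 := hψ0 ξ fun h => hξ ⟨by linarith [h.1], by linarith [h.2]⟩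
      simp [hu, this]
  simp only [hug]
  have hui : Integrable u := by
    have := hgs.continuous
    have := hψ.continuous
    refine Continuous.integrable_of_hasCompactSupport (by fun_prop) ?_
    exact ((hasCompactSupport_of_annulus hψ0).comp_left (g := ofReal) ofReal_zero).mul_left
  have hcorr : ∀ᵐ y : E, ‖∫ ξ, u (ξ + y) * conj (u ξ)‖ ≤
      D * (1 + ‖t • y‖) ^ (-(n + 1 : ℝ)) := by
    filter_upwards [compl_mem_ae_iff.2 (measure_singleton (0 : E))] with y hy
    have e1 : ∫ ξ, u (ξ + y) * conj (u ξ) = exp (I * (⟪x, y⟫ : ℝ)) *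
        ∫ ξ, exp (I * (-t * (g (ξ + y) - g ξ) : ℝ)) * (ψ ξ * ψ (ξ + y) : ℝ) := by
      rw [← integral_const_mul]
      congr 1
      ext ξ
      have e2 : conj (u ξ) = exp (-(I * (⟪x, ξ⟫ - t * g ξ : ℝ))) * (ψ ξ : ℂ) := by
        simp only [hu, map_mul, conj_ofReal, ← exp_conj, conj_I, neg_mul]
      rw [e2]
      simp only [hu]
      rw [mul_mul_mul_comm, ← exp_add, ← mul_assoc (exp (I * (⟪x, y⟫ : ℝ))), ← exp_add,
        inner_add_right]
      push_cast
      rw [mul_comm (ψ (ξ + y) : ℂ)]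
      congr 2
      ring
    rw [e1, norm_mul, mul_comm I, norm_exp_ofReal_mul_I, one_mul]
    have h0 := hC₀ y hy (-t)
    have h1 := hC₁ y hy (-t)
    rw [pow_zero, one_mul] at h0
    rw [abs_neg] at h1
    set R := ‖∫ ξ, exp (I * (-t * (g (ξ + y) - g ξ) : ℝ)) * (ψ ξ * ψ (ξ + y) : ℝ)‖ with hR
    have hR0 : 0 ≤ R := norm_nonneg _
    rw [norm_smul, Real.norm_eq_abs]
    set z := |t| * ‖y‖ with hz
    have hz0 : 0 ≤ z := by positivity
    have hpow : (1 + z) ^ (n + 1) ≤ 2 ^ n * (1 + z ^ (n + 1)) := by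
      simpa using add_pow_le zero_le_one hz0 (n + 1)
    have e3 : (1 + z) ^ (-(n + 1 : ℝ)) = ((1 + z) ^ (n + 1))⁻¹ := by
      rw [Real.rpow_neg (by positivity)]
      exact_mod_cast rfl
    rw [e3, ← div_eq_mul_inv, le_div_iff₀ (by positivity)]
    calc R * (1 + z) ^ (n + 1) ≤ R * (2 ^ n * (1 + z ^ (n + 1))) := by gcongr
      _ = 2 ^ n * (R + z ^ (n + 1) * R) := by ring
      _ ≤ D := by
        rw [hD]
        gcongr
        · exact h0.trans (le_abs_self _)
        · exact h1.trans (le_abs_self _)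
  have hsq := norm_integral_sq_le hui ((hint.comp_smul ht).const_mul D) hcorr
  rw [integral_const_mul, Measure.integral_comp_smul volume
    (fun y : E => (1 + ‖y‖) ^ (-(n + 1 : ℝ))) t, ← hM, smul_eq_mul, ← hn] at hsq
  have e4 : |(t ^ n)⁻¹| = (|t| ^ (-((n : ℝ) / 2))) ^ 2 := by
    rw [← Real.rpow_natCast (|t| ^ (-((n : ℝ) / 2))), ← Real.rpow_mul htp.le, abs_inv, abs_pow,
      ← Real.rpow_natCast |t|, ← Real.rpow_neg htp.le]
    congr 1
    push_cast
    ring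
  have hfin : ‖∫ ξ, u ξ‖ ≤ Real.sqrt (D * M) * |t| ^ (-((n : ℝ) / 2)) := by
    refine le_of_sq_le_sq ?_ (by positivity)
    rw [mul_pow, Real.sq_sqrt (by positivity), ← e4]
    linarith
  refine hfin.trans ?_
  gcongr
  linarith

end Dispersive

section Interpolation

variable {X : Type*} [MeasurableSpace X] {μ : Measure X} [SFinite μ]

lemma lintegral_Ioc_rpow {r L : ℝ} (hr : 2 < r) (hL : 0 ≤ L) :
    ∫⁻ z in Set.Ioc 0 L, ENNReal.ofReal (z ^ (r - 3)) = ENNReal.ofReal (L ^ (r - 2) / (r - 2)) := by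
  rw [← ofReal_integral_eq_lintegral_ofReal]
  · rw [← intervalIntegral.integral_of_le hL, integral_rpow (Or.inl (by linarith)),
      show r - 3 + 1 = r - 2 by ring, Real.zero_rpow (by linarith), sub_zero]
  · exact (intervalIntegrable_iff_integrableOn_Ioc_of_le hL).1
      (intervalIntegral.intervalIntegrable_rpow' (by linarith))
  · filter_upwards [ae_restrict_mem measurableSet_Ioc] with z hz
    exact Real.rpow_nonneg hz.1.le _

/-- The weak-type estimate obtained by truncating `f` at the height balancing the two endpoint
bounds. -/
lemma meas_lt_le_of_L1_L2 {T : (X → ℂ) → X → ℂ} {A : ℝ} (hA : 0 < A)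
    (hadd : ∀ g₁ g₂, Integrable g₁ μ → Integrable g₂ μ → T (g₁ + g₂) = T g₁ + T g₂)
    (h1 : ∀ g, Integrable g μ → ∀ x, ‖T g x‖ ≤ A * ∫ y, ‖g y‖ ∂μ)
    (hm : ∀ g, Integrable g μ → AEStronglyMeasurable (T g) μ)
    (h2 : ∀ g, Integrable g μ → MemLp g 2 μ → eLpNorm (T g) 2 μ ≤ eLpNorm g 2 μ)
    {f : X → ℂ} (hfm : Measurable f) (hf1 : Integrable f μ) (hf2 : MemLp f 2 μ) {r : ℝ}
    (hr : 2 < r) (hfp : Integrable (fun x => ‖f x‖ ^ (r / (r - 1))) μ) {M : ℝ} (hM : 0 < M)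
    (hfM : ∫ x, ‖f x‖ ^ (r / (r - 1)) ∂μ = M) {z : ℝ} (hz : 0 < z) :
    μ {x | z < ‖T f x‖} ≤ ENNReal.ofReal (4 / z ^ 2) *
      ∫⁻ x in {x | ‖f x‖ ≤ (2 * A * M / z) ^ (r - 1)}, ENNReal.ofReal (‖f x‖ ^ 2) ∂μ := by
  set s := (2 * A * M / z) ^ (r - 1) with hs
  have hs0 : 0 < s := Real.rpow_pos_of_pos (by positivity) _
  have hr1 : 0 < r - 1 := by linarith
  let S : Set X := {x | ‖f x‖ ≤ s}
  have hS : MeasurableSet S := measurableSet_le hfm.norm measurable_const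
  have hsplit : f = Sᶜ.indicator f + S.indicator f := (Set.indicator_compl_add_self S f).symm
  have hl : Integrable (Sᶜ.indicator f) μ := hf1.indicator hS.compl
  have hsm : Integrable (S.indicator f) μ := hf1.indicator hS
  have hsp : s ^ (1 - r / (r - 1)) = z / (2 * A * M) := by
    rw [hs, ← Real.rpow_mul (by positivity),
      show (r - 1) * (1 - r / (r - 1)) = -1 by field_simp; ring, Real.rpow_neg_one, inv_div]
  have hlarge : ∀ x, ‖T (Sᶜ.indicator f) x‖ ≤ z / 2 := by
    intro x
    refine (h1 _ hl x).trans ?_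
    have hle : ∫ y, ‖Sᶜ.indicator f y‖ ∂μ ≤ ∫ y, z / (2 * A * M) * ‖f y‖ ^ (r / (r - 1)) ∂μ := by
      refine integral_mono hl.norm (hfp.const_mul _) fun y => ?_
      by_cases hy : y ∈ S
      · rw [Set.indicator_of_notMem (by simpa using hy), norm_zero]
        positivity
      · rw [Set.indicator_of_mem (by simpa using hy), ← hsp]
        have hy' : s < ‖f y‖ := not_le.1 hy
        have hy0 : 0 < ‖f y‖ := hs0.trans hy'
        calc ‖f y‖ = ‖f y‖ ^ (1 - r / (r - 1)) * ‖f y‖ ^ (r / (r - 1)) := by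
              rw [← Real.rpow_add hy0]; simp
          _ ≤ _ := by
              gcongr ?_ * _
              refine Real.rpow_le_rpow_of_nonpos hs0 hy'.le ?_
              rw [sub_nonpos, le_div_iff₀ hr1]
              linarith
    rw [integral_const_mul, hfM] at hle
    calc A * ∫ y, ‖Sᶜ.indicator f y‖ ∂μ ≤ A * (z / (2 * A * M) * M) := by gcongr
      _ = z / 2 := by field_simp
  have hsub : {x | z < ‖T f x‖} ⊆ {x | ENNReal.ofReal (z / 2) ≤ ‖T (S.indicator f) x‖ₑ} := by
    intro x hx
    have e : T f x = T (Sᶜ.indicator f) x + T (S.indicator f) x := by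
      conv_lhs => rw [hsplit, hadd _ _ hl hsm]
      rfl
    have hx' : z < ‖T f x‖ := hx
    rw [e] at hx'
    have := norm_add_le (T (Sᶜ.indicator f) x) (T (S.indicator f) x)
    have := hlarge x
    rw [Set.mem_ofPred_eq, ← ofReal_norm]
    exact ENNReal.ofReal_le_ofReal (by linarith)
  have hz2 : ENNReal.ofReal (z / 2) ≠ 0 := by simpa using hz
  have hcheb := meas_ge_le_mul_pow_eLpNorm_enorm μ (p := 2) (by norm_num) (by norm_num)
    (hm _ hsm) (ε := ENNReal.ofReal (z / 2)) hz2 (by simp)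
  refine (measure_mono hsub).trans (hcheb.trans ?_)
  have hL2 : eLpNorm (T (S.indicator f)) 2 μ ^ (2 : ℝ≥0∞).toReal ≤
      ∫⁻ x in S, ENNReal.ofReal (‖f x‖ ^ 2) ∂μ := by
    refine (ENNReal.rpow_le_rpow (h2 _ hsm (hf2.indicator hS)) (by simp)).trans (le_of_eq ?_)
    rw [eLpNorm_eq_lintegral_rpow_enorm_toReal (by norm_num) (by norm_num), ← ENNReal.rpow_mul]
    rw [← lintegral_indicator hS]
    simp only [ENNReal.toReal_ofNat, one_div, ne_eq, OfNat.ofNat_ne_zero, not_false_eq_true,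
      inv_mul_cancel₀, ENNReal.rpow_one, ENNReal.rpow_ofNat]
    congr 1
    ext x
    by_cases hx : x ∈ S
    · rw [Set.indicator_of_mem hx, Set.indicator_of_mem hx, ENNReal.ofReal_pow (norm_nonneg _),
        ofReal_norm]
    · rw [Set.indicator_of_notMem hx, Set.indicator_of_notMem hx]; simp
  gcongr
  rw [ENNReal.toReal_ofNat, ENNReal.rpow_ofNat, ← ENNReal.ofReal_inv_of_pos (by positivity),
    ← ENNReal.ofReal_pow (by positivity)]
  refine ENNReal.ofReal_le_ofReal (le_of_eq ?_)
  field_simp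
  norm_num

theorem lintegral_rpow_le_of_L1_L2 {T : (X → ℂ) → X → ℂ} {A : ℝ} (hA : 0 < A)
    (hadd : ∀ g₁ g₂, Integrable g₁ μ → Integrable g₂ μ → T (g₁ + g₂) = T g₁ + T g₂)
    (h1 : ∀ g, Integrable g μ → ∀ x, ‖T g x‖ ≤ A * ∫ y, ‖g y‖ ∂μ)
    (hm : ∀ g, Integrable g μ → AEStronglyMeasurable (T g) μ)
    (h2 : ∀ g, Integrable g μ → MemLp g 2 μ → eLpNorm (T g) 2 μ ≤ eLpNorm g 2 μ)
    {f : X → ℂ} (hfm : Measurable f) (hf1 : Integrable f μ) (hf2 : MemLp f 2 μ) {r : ℝ}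
    (hr : 2 < r) (hfp : Integrable (fun x => ‖f x‖ ^ (r / (r - 1))) μ) {M : ℝ} (hM : 0 < M)
    (hfM : ∫ x, ‖f x‖ ^ (r / (r - 1)) ∂μ = M) :
    ∫⁻ x, ENNReal.ofReal (‖T f x‖ ^ r) ∂μ ≤
      ENNReal.ofReal (r * 4 * 2 ^ (r - 2) / (r - 2) * A ^ (r - 2) * M ^ (r - 1)) := by
  have hr1 : 0 < r - 1 := by linarith
  have hr2 : 0 < r - 2 := by linarith
  rw [lintegral_rpow_eq_lintegral_meas_lt_mul μ (Filter.Eventually.of_forall fun x => norm_nonneg _)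
    (hm f hf1).norm.aemeasurable (by linarith : 0 < r)]
  let L : X → ℝ := fun x => 2 * A * M * ‖f x‖ ^ (-(r - 1)⁻¹)
  have hL0 : ∀ x, 0 ≤ L x := fun x => by positivity
  have hLm : Measurable L := (hfm.norm.pow_const _).const_mul _
  let F : ℝ → X → ℝ≥0∞ := fun z x =>
    {y : ℝ × X | y.1 ≤ L y.2}.indicator
      (fun y => ENNReal.ofReal (4 * ‖f y.2‖ ^ 2) * ENNReal.ofReal (y.1 ^ (r - 3))) (z, x)
  have hFm : Measurable (Function.uncurry F) := by
    refine Measurable.indicator ?_ (measurableSet_le measurable_fst (hLm.comp measurable_snd))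
    fun_prop
  have hstep : ∀ z ∈ Set.Ioi (0 : ℝ),
      μ {x | z < ‖T f x‖} * ENNReal.ofReal (z ^ (r - 1)) ≤ ∫⁻ x, F z x ∂μ := by
    intro z hz
    have hz : 0 < z := hz
    have hS : MeasurableSet {x | ‖f x‖ ≤ (2 * A * M / z) ^ (r - 1)} :=
      measurableSet_le hfm.norm measurable_const
    refine (mul_le_mul_left (meas_lt_le_of_L1_L2 hA hadd h1 hm h2 hfm hf1 hf2 hr hfp hM hfM hz)
      _).trans ?_
    rw [mul_right_comm, ← ENNReal.ofReal_mul (by positivity), ← lintegral_const_mul _ (by fun_prop),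
      ← lintegral_indicator hS]
    refine lintegral_mono fun x => ?_
    by_cases hx : x ∈ {x | ‖f x‖ ≤ (2 * A * M / z) ^ (r - 1)}
    swap
    · rw [Set.indicator_of_notMem hx]; exact zero_le
    rw [Set.indicator_of_mem hx]
    rcases eq_or_lt_of_le (norm_nonneg (f x)) with h0 | h0
    · simp [← h0]
    have hzL : z ≤ L x := by
      have hx' : ‖f x‖ ≤ (2 * A * M / z) ^ (r - 1) := hx
      have h3 : ‖f x‖ ^ (r - 1)⁻¹ ≤ 2 * A * M / z := by
        have := Real.rpow_le_rpow h0.le hx' (inv_nonneg.2 hr1.le)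
        rwa [← Real.rpow_mul (by positivity), mul_inv_cancel₀ hr1.ne', Real.rpow_one] at this
      simp only [L]
      rw [Real.rpow_neg h0.le, ← div_eq_mul_inv, le_div_iff₀ (by positivity)]
      rw [le_div_iff₀ hz] at h3
      linarith
    simp only [F]
    rw [Set.indicator_of_mem (by exact hzL), ← ENNReal.ofReal_mul (by positivity),
      ← ENNReal.ofReal_mul (by positivity)]
    refine ENNReal.ofReal_le_ofReal (le_of_eq ?_)
    have : z ^ (r - 1) = z ^ (r - 3) * z ^ 2 := by
      rw [← Real.rpow_natCast z 2, ← Real.rpow_add hz]; congr 1; push_cast; ring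
    rw [this]
    field_simp
  have hinner : ∀ x, ∫⁻ z in Set.Ioi (0 : ℝ), F z x =
      ENNReal.ofReal (4 * (2 * A * M) ^ (r - 2) / (r - 2) * ‖f x‖ ^ (r / (r - 1))) := by
    intro x
    have e1 : ∀ z, F z x = (Set.Iic (L x)).indicator
        (fun z => ENNReal.ofReal (4 * ‖f x‖ ^ 2) * ENNReal.ofReal (z ^ (r - 3))) z := fun z => by
      by_cases hz : z ≤ L x
      · simp only [F]
        rw [Set.indicator_of_mem (by exact hz), Set.indicator_of_mem (by exact hz)]
      · simp only [F]
        rw [Set.indicator_of_notMem (by exact hz), Set.indicator_of_notMem (by exact hz)]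
    simp only [e1]
    rw [lintegral_indicator measurableSet_Iic, Measure.restrict_restrict measurableSet_Iic,
      Set.inter_comm, Set.Ioi_inter_Iic, lintegral_const_mul _ (by fun_prop),
      lintegral_Ioc_rpow hr (hL0 x), ← ENNReal.ofReal_mul (by positivity)]
    congr 1
    rcases eq_or_lt_of_le (norm_nonneg (f x)) with h0 | h0
    · rw [← h0, Real.zero_rpow (by positivity)]
      simp
    · simp only [L]
      rw [Real.mul_rpow (by positivity) (by positivity), ← Real.rpow_mul h0.le]
      have : ‖f x‖ ^ (r / (r - 1)) = ‖f x‖ ^ 2 * ‖f x‖ ^ (-(r - 1)⁻¹ * (r - 2)) := by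
        rw [← Real.rpow_natCast, ← Real.rpow_add h0]
        congr 1
        push_cast
        field_simp
        ring
      rw [this]
      ring
  calc _ ≤ ENNReal.ofReal r * ∫⁻ z in Set.Ioi (0 : ℝ), ∫⁻ x, F z x ∂μ := by
        exact mul_le_mul' le_rfl (setLIntegral_mono' measurableSet_Ioi hstep)
    _ = ENNReal.ofReal r * ∫⁻ x, (∫⁻ z in Set.Ioi (0 : ℝ), F z x) ∂μ := by
        rw [lintegral_lintegral_swap hFm.aemeasurable]
    _ = _ := by
        simp only [hinner]
        rw [← ofReal_integral_eq_lintegral_ofReal (hfp.const_mul _)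
          (Filter.Eventually.of_forall fun x => by positivity), integral_const_mul, hfM,
          ← ENNReal.ofReal_mul (by linarith)]
        congr 1
        have e2 : M ^ (r - 1) = M ^ (r - 2) * M := by
          rw [← Real.rpow_add_one hM.ne']; congr 1; ring
        rw [Real.mul_rpow (by positivity) hM.le, Real.mul_rpow (by positivity) hA.le, e2]
        ring

/-- Marcinkiewicz interpolation between an `L¹ → L^∞` and an `L² → L²` bound. -/
theorem eLpNorm_le_of_L1_L2 {T : (X → ℂ) → X → ℂ} {A : ℝ} (hA : 0 < A)
    (hadd : ∀ g₁ g₂, Integrable g₁ μ → Integrable g₂ μ → T (g₁ + g₂) = T g₁ + T g₂)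
    (h1 : ∀ g, Integrable g μ → ∀ x, ‖T g x‖ ≤ A * ∫ y, ‖g y‖ ∂μ)
    (hm : ∀ g, Integrable g μ → AEStronglyMeasurable (T g) μ)
    (h2 : ∀ g, Integrable g μ → MemLp g 2 μ → eLpNorm (T g) 2 μ ≤ eLpNorm g 2 μ)
    {f : X → ℂ} (hfm : Measurable f) (hf1 : Integrable f μ) (hf2 : MemLp f 2 μ) {r : ℝ}
    (hr : 2 < r) (hfp : MemLp f (ENNReal.ofReal (r / (r - 1))) μ) :
    eLpNorm (T f) (ENNReal.ofReal r) μ ≤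
      ENNReal.ofReal ((r * 4 * 2 ^ (r - 2) / (r - 2)) ^ r⁻¹ * A ^ (1 - 2 / r)) *
        eLpNorm f (ENNReal.ofReal (r / (r - 1))) μ := by
  have hr0 : 0 < r := by linarith
  have hr1 : 0 < r - 1 := by linarith
  have hr2 : 0 < r - 2 := by linarith
  have hp0 : 0 < r / (r - 1) := by positivity
  have hp0' : ENNReal.ofReal (r / (r - 1)) ≠ 0 := by simpa using hp0
  have hint : Integrable (fun x => ‖f x‖ ^ (r / (r - 1))) μ := by
    have := hfp.integrable_norm_rpow hp0' ENNReal.ofReal_ne_top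
    rwa [ENNReal.toReal_ofReal hp0.le] at this
  rcases (integral_nonneg fun x => by positivity :
    0 ≤ ∫ x, ‖f x‖ ^ (r / (r - 1)) ∂μ).eq_or_lt with h0 | hM
  · have hf0 : f =ᵐ[μ] 0 := by
      have := (integral_eq_zero_iff_of_nonneg (fun x => by positivity) hint).1 h0.symm
      filter_upwards [this] with x hx
      simpa [Real.rpow_eq_zero (norm_nonneg (f x)) hp0.ne'] using hx
    have hT : T f = 0 := by
      ext x
      have := h1 f hf1 x
      rw [integral_eq_zero_of_ae (hf0.mono fun y hy => by simp [hy])] at this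
      simpa using this
    simp [hT]
  · have key := lintegral_rpow_le_of_L1_L2 hA hadd h1 hm h2 hfm hf1 hf2 hr hint hM rfl
    rw [hfp.eLpNorm_eq_integral_rpow_norm hp0' ENNReal.ofReal_ne_top,
      eLpNorm_eq_lintegral_rpow_enorm_toReal (by simpa using hr0) ENNReal.ofReal_ne_top,
      ENNReal.toReal_ofReal hr0.le, ENNReal.toReal_ofReal hp0.le,
      ← ENNReal.ofReal_mul (by positivity)]
    have e : ∀ x, ‖T f x‖ₑ ^ r = ENNReal.ofReal (‖T f x‖ ^ r) := fun x => by
      rw [← ENNReal.ofReal_rpow_of_nonneg (norm_nonneg _) hr0.le, ofReal_norm]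
    simp only [e]
    refine (ENNReal.rpow_le_rpow key (by positivity)).trans ?_
    rw [ENNReal.ofReal_rpow_of_nonneg (by positivity) (by positivity)]
    refine ENNReal.ofReal_le_ofReal (le_of_eq ?_)
    rw [Real.mul_rpow (by positivity) (by positivity),
      Real.mul_rpow (by positivity) (by positivity),
      ← Real.rpow_mul hA.le, ← Real.rpow_mul hM.le]
    congr 2
    · rw [one_div]
    · congr 1; field_simp
    · field_simp

end Interpolation

section Convolution

open scoped SchwartzMap FourierTransform Convolution

variable {V : Type*} [NormedAddCommGroup V] [InnerProductSpace ℝ V] [FiniteDimensional ℝ V]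
  [MeasurableSpace V] [BorelSpace V]

lemma SchwartzMap.bddAbove_range_norm (K : 𝓢(V, ℂ)) : BddAbove (Set.range fun x => ‖K x‖) := by
  obtain ⟨C, -, hC⟩ := K.decay 0 0
  exact ⟨C, by rintro _ ⟨x, rfl⟩; simpa using hC x⟩

lemma SchwartzMap.convolutionExistsAt_of_integrable (K : 𝓢(V, ℂ)) {g : V → ℂ} (hg : Integrable g)
    (x : V) : ConvolutionExistsAt g K x (ContinuousLinearMap.mul ℂ ℂ) volume :=
  BddAbove.convolutionExistsAt (s := Set.univ) _ (by simpa using K.bddAbove_range_norm)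
    MeasurableSet.univ (by simp) hg.integrableOn K.continuous.aestronglyMeasurable

lemma SchwartzMap.norm_convolution_le (K : 𝓢(V, ℂ)) {A : ℝ} (hA : ∀ x, ‖K x‖ ≤ A) {g : V → ℂ}
    (hg : Integrable g) (x : V) :
    ‖(g ⋆[ContinuousLinearMap.mul ℂ ℂ, volume] K) x‖ ≤ A * ∫ y, ‖g y‖ := by
  rw [mul_comm, ← integral_mul_const]
  refine norm_integral_le_of_norm_le (hg.norm.mul_const A) (Filter.Eventually.of_forall fun y => ?_)
  simp only [ContinuousLinearMap.mul_apply', norm_mul]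
  gcongr
  exact hA _

lemma SchwartzMap.continuous_convolution (K : 𝓢(V, ℂ)) {g : V → ℂ} (hg : Integrable g) :
    Continuous (g ⋆[ContinuousLinearMap.mul ℂ ℂ, volume] K) :=
  BddAbove.continuous_convolution_right_of_integrable _ K.bddAbove_range_norm hg K.continuous

lemma SchwartzMap.convolution_add_left (K : 𝓢(V, ℂ)) {g₁ g₂ : V → ℂ} (h₁ : Integrable g₁)
    (h₂ : Integrable g₂) : (g₁ + g₂) ⋆[ContinuousLinearMap.mul ℂ ℂ, volume] K =
      (g₁ ⋆[ContinuousLinearMap.mul ℂ ℂ, volume] K) +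
        (g₂ ⋆[ContinuousLinearMap.mul ℂ ℂ, volume] K) :=
  ConvolutionExists.add_distrib (K.convolutionExistsAt_of_integrable h₁)
    (K.convolutionExistsAt_of_integrable h₂)

lemma SchwartzMap.eLpNorm_fourier (h : 𝓢(V, ℂ)) :
    eLpNorm (𝓕 h : 𝓢(V, ℂ)) 2 volume = eLpNorm h 2 volume := by
  have key := SchwartzMap.norm_fourier_toL2_eq h
  have h1 : eLpNorm (𝓕 h : 𝓢(V, ℂ)) 2 volume ≠ ⊤ := (SchwartzMap.memLp _ 2 volume).eLpNorm_ne_top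
  have h2 : eLpNorm h 2 volume ≠ ⊤ := (SchwartzMap.memLp _ 2 volume).eLpNorm_ne_top
  rw [SchwartzMap.norm_toLp, SchwartzMap.norm_toLp] at key
  rw [← ENNReal.ofReal_toReal h1, ← ENNReal.ofReal_toReal h2, key]

lemma SchwartzMap.eLpNorm_convolution_le (K : 𝓢(V, ℂ)) (hK : ∀ ξ, ‖𝓕 K ξ‖ ≤ 1) (g : 𝓢(V, ℂ)) :
    eLpNorm (⇑g ⋆[ContinuousLinearMap.mul ℂ ℂ, volume] K) 2 volume ≤ eLpNorm g 2 volume := by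
  have e : (⇑g ⋆[ContinuousLinearMap.mul ℂ ℂ, volume] K) =
      SchwartzMap.convolution (ContinuousLinearMap.mul ℂ ℂ) g K :=
    funext fun x => (SchwartzMap.convolution_apply _ _ _ x).symm
  rw [e, ← SchwartzMap.eLpNorm_fourier, SchwartzMap.fourier_convolution,
    ← SchwartzMap.eLpNorm_fourier g]
  refine eLpNorm_mono fun x => ?_
  rw [SchwartzMap.pairing_apply_apply]
  simpa using mul_le_of_le_one_right (norm_nonneg _) (hK x)

lemma SchwartzMap.eLpNorm_convolution_le_of_integrable (K : 𝓢(V, ℂ)) (hK : ∀ ξ, ‖𝓕 K ξ‖ ≤ 1)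
    {g : V → ℂ} (hg : Integrable g) (hg2 : MemLp g 2) :
    eLpNorm (g ⋆[ContinuousLinearMap.mul ℂ ℂ, volume] K) 2 volume ≤ eLpNorm g 2 volume := by
  have hε : ∀ n : ℕ, (0 : ℝ) < 1 / ((n : ℝ) + 1) := fun n => by positivity
  choose φ hφc hφs hφ using fun n : ℕ => hg2.exist_eLpNorm_sub_le (by simp) (by norm_num) (hε n)
  have hε0 : Filter.Tendsto (fun n : ℕ => ENNReal.ofReal (1 / ((n : ℝ) + 1))) Filter.atTop
      (nhds 0) := by
    simpa using ENNReal.tendsto_ofReal tendsto_one_div_add_atTop_nhds_zero_nat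
  let Φ : ℕ → 𝓢(V, ℂ) := fun n => (hφc n).toSchwartzMap (hφs n)
  have hΦ : ∀ n, eLpNorm (⇑(Φ n) - g) 2 volume ≤ ENNReal.ofReal (1 / ((n : ℝ) + 1)) := fun n => by
    rw [eLpNorm_sub_comm]; exact hφ n
  have hpt : ∀ x, Filter.Tendsto (fun n => (⇑(Φ n) ⋆[ContinuousLinearMap.mul ℂ ℂ, volume] K) x)
      Filter.atTop (nhds ((g ⋆[ContinuousLinearMap.mul ℂ ℂ, volume] K) x)) := by
    intro x
    have hKx : MemLp (fun t => K (x - t)) 2 volume :=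
      (K.memLp 2).comp_measurePreserving (volume.measurePreserving_sub_left x)
    refine tendsto_integral_of_L1' _ (K.convolutionExistsAt_of_integrable hg x).1
      (Filter.Eventually.of_forall fun n =>
        K.convolutionExistsAt_of_integrable (Φ n).integrable x) ?_
    have hb : ∀ n, eLpNorm ((fun t => (ContinuousLinearMap.mul ℂ ℂ) (Φ n t) (K (x - t))) -
        fun t => (ContinuousLinearMap.mul ℂ ℂ) (g t) (K (x - t))) 1 volume ≤
        ENNReal.ofReal (1 / ((n : ℝ) + 1)) * eLpNorm (fun t => K (x - t)) 2 volume := by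
      intro n
      have e : ((fun t => (ContinuousLinearMap.mul ℂ ℂ) (Φ n t) (K (x - t))) -
        fun t => (ContinuousLinearMap.mul ℂ ℂ) (g t) (K (x - t))) =
          (⇑(Φ n) - g) • fun t => K (x - t) := by
        ext t; simp [sub_mul]
      rw [e]
      refine (eLpNorm_smul_le_mul_eLpNorm (p := 2) (q := 2) hKx.1
        (((Φ n).memLp 2).sub hg2).1).trans ?_
      gcongr
      exact hΦ n
    refine tendsto_of_tendsto_of_tendsto_of_le_of_le tendsto_const_nhds ?_ (fun n => zero_le) hb
    simpa using ENNReal.Tendsto.mul_const hε0 (Or.inr hKx.eLpNorm_ne_top)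
  refine (Lp.eLpNorm_lim_le_liminf_eLpNorm
    (fun n => (K.continuous_convolution (Φ n).integrable).aestronglyMeasurable) _
    (Filter.Eventually.of_forall hpt)).trans ?_
  have hlim : Filter.Tendsto
      (fun n : ℕ => eLpNorm g 2 volume + ENNReal.ofReal (1 / ((n : ℝ) + 1))) Filter.atTop
      (nhds (eLpNorm g 2 volume)) := by
    simpa using hε0.const_add (eLpNorm g 2 volume)
  rw [← hlim.liminf_eq]
  refine Filter.liminf_le_liminf (Filter.Eventually.of_forall fun n => ?_)
  refine (K.eLpNorm_convolution_le hK (Φ n)).trans ?_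
  calc eLpNorm (Φ n) 2 volume = eLpNorm (g + (⇑(Φ n) - g)) 2 volume := by simp
    _ ≤ _ := (eLpNorm_add_le hg2.1 (((Φ n).memLp 2).sub hg2).1 (by norm_num)).trans
        (by gcongr; exact hΦ n)

end Convolution

section Multiplier

open scoped SchwartzMap FourierTransform Convolution ContDiff

variable {E : Type*} [NormedAddCommGroup E] [InnerProductSpace ℝ E] [FiniteDimensional ℝ E]
  [MeasurableSpace E] [BorelSpace E]

lemma exists_schwartzMap_exp_mul_cutoff {ψ : E → ℝ} (hψ : ContDiff ℝ ∞ ψ)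
    (hψ0 : ∀ x ∉ annulus E (1 / 4) 4, ψ x = 0) (p s : ℝ) {c : ℝ} (hc : c ≠ 0) :
    ∃ M : 𝓢(E, ℂ), ∀ η, M η = exp (I * (-(s * ‖c • η‖ ^ p) : ℝ)) * (ψ (c • η) : ℂ) := by
  obtain ⟨χ, hχ, hχ1, hχ0, -⟩ :=
    exists_annulus_cutoff (E := E) (a := 1 / 4) (b := 4) (a' := 1 / 8) (b' := 5)
      (by norm_num) (by norm_num)
  have hφ := contDiff_cutoff_mul_norm_rpow hχ (by norm_num) hχ0 p
  let m : E → ℂ := fun ζ => exp (I * (-(s * ‖ζ‖ ^ p) : ℝ)) * (ψ ζ : ℂ)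
  have hm : m = fun ζ => exp (I * (-(s * (χ ζ * ‖ζ‖ ^ p)) : ℝ)) * (ψ ζ : ℂ) := by
    ext ζ
    by_cases hζ : ζ ∈ annulus E (1 / 4) 4
    · simp only [m]
      rw [(hχ1 ζ hζ).self_of_nhds, one_mul]
    · simp [m, hψ0 ζ hζ]
  have hms : ContDiff ℝ ∞ m := by
    rw [hm]
    refine (contDiff_exp.comp (contDiff_const.mul
      (ofRealCLM.contDiff.comp (contDiff_const.mul hφ).neg))).mul (ofRealCLM.contDiff.comp hψ)
  have hmc : HasCompactSupport m :=
    ((hasCompactSupport_of_annulus hψ0).comp_left (g := ofReal) ofReal_zero).mul_left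
  exact ⟨(hmc.comp_smul hc).toSchwartzMap (hms.comp (contDiff_const_smul c)), fun η => rfl⟩

lemma norm_fourierInv_exp_mul_cutoff_le {ψ : E → ℝ} {p C : ℝ}
    (hC : ∀ t ≠ 0, ∀ x : E, ‖∫ ξ : E, exp (I * (⟪x, ξ⟫ - t * ‖ξ‖ ^ p : ℝ)) * (ψ ξ : ℂ)‖ ≤
      C * |t| ^ (-((Module.finrank ℝ E : ℝ) / 2)))
    {s c : ℝ} (hs : s ≠ 0) (hc : 0 < c) {M : 𝓢(E, ℂ)}
    (hM : ∀ η, M η = exp (I * (-(s * ‖c • η‖ ^ p) : ℝ)) * (ψ (c • η) : ℂ)) (x : E) :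
    ‖(𝓕⁻ M : 𝓢(E, ℂ)) x‖ ≤
      (c ^ Module.finrank ℝ E)⁻¹ * (C * |s| ^ (-((Module.finrank ℝ E : ℝ) / 2))) := by
  rw [SchwartzMap.fourierInv_coe, Real.fourierInv_eq']
  let F : E → ℂ := fun ζ =>
    exp (I * (⟪(2 * Real.pi / c) • x, ζ⟫ - s * ‖ζ‖ ^ p : ℝ)) * (ψ ζ : ℂ)
  have e : ∀ v : E, exp (((2 * Real.pi * ⟪v, x⟫ : ℝ) : ℂ) * I) • M v = F (c • v) := by
    intro v
    simp only [F]
    rw [hM, smul_eq_mul, ← mul_assoc, ← exp_add]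
    congr 2
    rw [real_inner_smul_left, real_inner_smul_right, real_inner_comm]
    have : 2 * Real.pi / c * (c * ⟪x, v⟫) = 2 * Real.pi * ⟪x, v⟫ := by field_simp
    rw [this]
    push_cast
    ring
  simp only [e]
  rw [Measure.integral_comp_smul, norm_smul, Real.norm_eq_abs, abs_abs, abs_of_pos (by positivity)]
  gcongr
  exact hC s hs _

end Multiplier

section Propagator

open scoped SchwartzMap FourierTransform Convolution ContDiff

variable {d : ℕ}

lemma FT_two_pi_smul (f : Ed d → ℂ) (η : Ed d) : FT f ((2 * Real.pi) • η) = 𝓕 f η := by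
  rw [FT, Real.fourier_eq']
  congr 1
  ext x
  rw [real_inner_smul_right, smul_eq_mul]
  congr 2
  push_cast
  ring

lemma FTinv_eq_fourierInv (g : Ed d → ℂ) (x : Ed d) :
    FTinv g x = 𝓕⁻ (fun η => g ((2 * Real.pi) • η)) x := by
  rw [FTinv, Real.fourierInv_eq']
  let F : Ed d → ℂ := fun ξ => exp (I * (⟪x, ξ⟫ : ℝ)) * g ξ
  have e : ∀ v : Ed d, exp (((2 * Real.pi * ⟪v, x⟫ : ℝ) : ℂ) * I) • g ((2 * Real.pi) • v) =
      F ((2 * Real.pi) • v) := by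
    intro v
    simp only [F]
    rw [smul_eq_mul, real_inner_smul_right, real_inner_comm]
    congr 2
    push_cast
    ring
  simp only [e]
  rw [Measure.integral_comp_smul, finrank_euclideanSpace_fin, real_smul,
    abs_of_pos (by positivity), Real.rpow_neg (by positivity), Real.rpow_natCast]

/-- On functions frequency-localized at `|ξ| ∼ 2^k` the propagator is convolution with a kernel
that obeys the dispersive bound and has Fourier transform bounded by one. -/
theorem exists_fprop_kernel (hd : 1 ≤ d) {α : ℝ} (hα : 1 / 2 < α) (hα1 : α < 1) :
    ∃ C : ℝ, 0 < C ∧ ∀ (k : ℤ) (t : ℝ), t ≠ 0 → ∃ K : 𝓢(Ed d, ℂ),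
      (∀ ξ, ‖(𝓕 K : 𝓢(Ed d, ℂ)) ξ‖ ≤ 1) ∧
      (∀ x, ‖K x‖ ≤ C * (2 : ℝ) ^ ((k : ℝ) * d * (1 - α)) * |t| ^ (-((d : ℝ) / 2))) ∧
      ∀ f : 𝓢(Ed d, ℂ),
        (∀ ξ : Ed d, FT (⇑f) ξ ≠ 0 → (2 : ℝ) ^ (k - 1) ≤ ‖ξ‖ ∧ ‖ξ‖ ≤ (2 : ℝ) ^ (k + 1)) →
        fprop α t f = ⇑f ⋆[ContinuousLinearMap.mul ℂ ℂ, volume] K := by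
  have : NeZero d := ⟨by omega⟩
  have : Nontrivial (Ed d) := inferInstance
  obtain ⟨ψ, hψ, hψ1, hψ0, hψb, C, hC0, hC⟩ :=
    exists_dispersive_kernel_bound (E := Ed d) (p := 2 * α) (by linarith) (by linarith)
  have hpi := Real.pi_pos
  refine ⟨((2 * Real.pi) ^ d)⁻¹ * C, by positivity, fun k t ht => ?_⟩
  have h2 : (0 : ℝ) < 2 ^ k := by positivity
  set c : ℝ := 2 * Real.pi / 2 ^ k with hc
  have hc0 : 0 < c := by positivity
  set s : ℝ := t * (2 ^ k) ^ (2 * α) with hs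
  have hs0 : s ≠ 0 := mul_ne_zero ht (Real.rpow_pos_of_pos h2 _).ne'
  obtain ⟨M, hM⟩ := exists_schwartzMap_exp_mul_cutoff hψ hψ0 (2 * α) s hc0.ne'
  refine ⟨𝓕⁻ M, fun ξ => ?_, fun x => ?_, fun f hf => ?_⟩
  · rw [FourierTransform.fourier_fourierInv_eq, hM, norm_mul, mul_comm I, norm_exp_ofReal_mul_I,
      one_mul, norm_real, Real.norm_of_nonneg (hψb _).1]
    exact (hψb _).2
  · refine (norm_fourierInv_exp_mul_cutoff_le hC hs0 hc0 hM x).trans (le_of_eq ?_)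
    rw [finrank_euclideanSpace_fin, hs, hc, abs_mul, abs_of_pos (Real.rpow_pos_of_pos h2 _),
      Real.mul_rpow (abs_nonneg _) (by positivity), ← Real.rpow_mul h2.le, div_pow, inv_div,
      ← Real.rpow_natCast (2 ^ k) d, ← Real.rpow_intCast, ← Real.rpow_mul zero_le_two,
      ← Real.rpow_mul zero_le_two]
    have : (2 : ℝ) ^ ((k : ℝ) * d * (1 - α)) =
        2 ^ ((k : ℝ) * d) * 2 ^ ((k : ℝ) * (2 * α * -((d : ℝ) / 2))) := by
      rw [← Real.rpow_add two_pos]; congr 1; ring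
    rw [this]
    ring
  · ext x
    rw [← SchwartzMap.convolution_apply]
    have e1 : SchwartzMap.convolution (ContinuousLinearMap.mul ℂ ℂ) f (𝓕⁻ M : 𝓢(Ed d, ℂ)) =
        𝓕⁻ (SchwartzMap.pairing (ContinuousLinearMap.mul ℂ ℂ) (𝓕 f) M) := by
      have h := SchwartzMap.fourier_convolution (ContinuousLinearMap.mul ℂ ℂ) f (𝓕⁻ M : 𝓢(Ed d, ℂ))
      rw [FourierTransform.fourier_fourierInv_eq] at h
      rw [← h, FourierTransform.fourierInv_fourier_eq]
    rw [e1, SchwartzMap.fourierInv_coe, fprop, FTinv_eq_fourierInv]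
    refine congrFun (congrArg _ (funext fun η => ?_)) x
    rw [SchwartzMap.pairing_apply_apply, ContinuousLinearMap.mul_apply', FT_two_pi_smul,
      SchwartzMap.fourier_coe, hM]
    by_cases h : 𝓕 (⇑f) η = 0
    · simp [h]
    · have hη := hf ((2 * Real.pi) • η) (by rwa [FT_two_pi_smul])
      have hn : ‖(2 * Real.pi) • η‖ = 2 ^ k * ‖c • η‖ := by
        rw [norm_smul, norm_smul, Real.norm_of_nonneg (by positivity),
          Real.norm_of_nonneg (by positivity), hc]
        field_simp
      have hmem : c • η ∈ annulus (Ed d) (1 / 2) 2 := by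
        rw [hn, zpow_sub_one₀ two_ne_zero, zpow_add_one₀ two_ne_zero] at hη
        refine ⟨?_, ?_⟩
        · refine le_of_mul_le_mul_left ?_ h2
          simpa using hη.1
        · exact le_of_mul_le_mul_left hη.2 h2
      rw [hψ1 _ hmem, hn, Real.mul_rpow h2.le (norm_nonneg _), ofReal_one, mul_one, mul_comm]
      congr 2
      rw [hs]
      push_cast
      ring

end Propagator

lemma ENNReal.eq_ofReal_of_conjugate {r : ℝ} (hr : 1 < r) {rc : ℝ≥0∞}
    (h : (ENNReal.ofReal r)⁻¹ + rc⁻¹ = 1) : rc = ENNReal.ofReal (r / (r - 1)) := by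
  have hr0 : 0 < r := by linarith
  have hr1 : 0 < r - 1 := by linarith
  have hne : (ENNReal.ofReal r)⁻¹ ≠ ⊤ := by simpa using hr0
  have h1 : rc⁻¹ = ENNReal.ofReal ((r - 1) / r) := by
    rw [ENNReal.eq_sub_of_add_eq' one_ne_top ((add_comm _ _).trans h),
      ← ENNReal.ofReal_inv_of_pos hr0, ← ENNReal.ofReal_one,
      ← ENNReal.ofReal_sub _ (by positivity)]
    congr 1
    field_simp
  rw [← inv_inv rc, h1, ← ENNReal.ofReal_inv_of_pos (by positivity), inv_div]

lemma ENNReal.toReal_one_sub_two_mul_inv {r : ℝ} (hr : 2 ≤ r) :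
    (1 - 2 * (ENNReal.ofReal r)⁻¹).toReal = 1 - 2 / r := by
  have hr0 : 0 < r := by linarith
  have e : 2 * (ENNReal.ofReal r)⁻¹ = ENNReal.ofReal (2 / r) := by
    rw [← ENNReal.ofReal_inv_of_pos hr0, div_eq_mul_inv, ENNReal.ofReal_mul zero_le_two,
      ENNReal.ofReal_ofNat]
  have h1 : 2 / r ≤ 1 := (div_le_one hr0).2 hr
  rw [e, ← ENNReal.ofReal_one, ← ENNReal.ofReal_sub _ (by positivity),
    ENNReal.toReal_ofReal (by linarith)]

theorem stmt5 (d : ℕ) (hd : 1 ≤ d) (α : ℝ) (hα : 1/2 < α) (hα1 : α < 1)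
    (r rc : ℝ≥0∞) (hr2 : 2 ≤ r) (hconj : r⁻¹ + rc⁻¹ = 1) :
    ∃ C : ℝ, 0 < C ∧ ∀ (k : ℤ) (t : ℝ), t ≠ 0 →
      ∀ f : SchwartzMap (Ed d) ℂ,
        (∀ ξ : Ed d, FT (⇑f) ξ ≠ 0 → (2:ℝ) ^ (k - 1) ≤ ‖ξ‖ ∧ ‖ξ‖ ≤ (2:ℝ) ^ (k + 1)) →
        eLpNorm (fprop α t (⇑f)) r volume
          ≤ ENNReal.ofReal (C * (2:ℝ) ^ ((k : ℝ) * d * (1 - α) * ((1 - 2 * r⁻¹ : ℝ≥0∞)).toReal)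
                * |t| ^ (-((d : ℝ) / 2) * ((1 - 2 * r⁻¹ : ℝ≥0∞)).toReal))
              * eLpNorm (⇑f) rc volume := by
  obtain ⟨C, hC0, hC⟩ := exists_fprop_kernel hd hα hα1
  rcases eq_or_ne r ⊤ with rfl | hrtop
  · have hrc : rc = 1 := by simpa using hconj
    refine ⟨C, hC0, fun k t ht f hf => ?_⟩
    obtain ⟨K, -, hK1, hK⟩ := hC k t ht
    rw [hK f hf, hrc, eLpNorm_exponent_top, eLpNorm_one_eq_lintegral_enorm,
      ← ofReal_integral_norm_eq_lintegral_enorm f.integrable,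
      ← ENNReal.ofReal_mul (by positivity)]
    refine eLpNormEssSup_le_of_ae_bound (Filter.Eventually.of_forall fun x => ?_)
    simpa using K.norm_convolution_le hK1 f.integrable x
  obtain ⟨ρ, hρ, rfl⟩ : ∃ ρ : ℝ, 2 ≤ ρ ∧ r = ENNReal.ofReal ρ :=
    ⟨r.toReal, by simpa using ENNReal.toReal_mono hrtop hr2, (ENNReal.ofReal_toReal hrtop).symm⟩
  rw [ENNReal.eq_ofReal_of_conjugate (by linarith) hconj, ENNReal.toReal_one_sub_two_mul_inv hρ]
  rcases hρ.eq_or_lt with rfl | hρ'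
  · refine ⟨1, one_pos, fun k t ht f hf => ?_⟩
    obtain ⟨K, hK2, -, hK⟩ := hC k t ht
    rw [hK f hf]
    norm_num
    exact K.eLpNorm_convolution_le hK2 f
  · have hρ2 : 0 < ρ - 2 := by linarith
    have hρ0 : 0 < ρ := by linarith
    refine ⟨(ρ * 4 * 2 ^ (ρ - 2) / (ρ - 2)) ^ ρ⁻¹ * C ^ (1 - 2 / ρ), by positivity,
      fun k t ht f hf => ?_⟩
    obtain ⟨K, hK2, hK1, hK⟩ := hC k t ht
    have ht0 : 0 < |t| := abs_pos.2 ht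
    rw [hK f hf]
    refine (eLpNorm_le_of_L1_L2 (T := fun g => convolution g K (ContinuousLinearMap.mul ℂ ℂ) volume)
      (by positivity) (fun _ _ => K.convolution_add_left)
      (fun _ hg => K.norm_convolution_le hK1 hg)
      (fun _ hg => (K.continuous_convolution hg).aestronglyMeasurable)
      (fun _ => K.eLpNorm_convolution_le_of_integrable hK2) f.continuous.measurable f.integrable
      (f.memLp 2) hρ' (f.memLp _)).trans (le_of_eq ?_)
    congr 2
    rw [Real.mul_rpow (by positivity) (by positivity),
      Real.mul_rpow (by positivity) (by positivity),
      ← Real.rpow_mul zero_le_two, ← Real.rpow_mul ht0.le]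
    ring

end
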